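/- arXiv:0903.2773 — 3 statements merged into one kernel-verified Lean document; each statement's English description precedes it below -/
import Mathlib

section
/- Let f : X → Y be a simplicial map of finite simplicial complexes, and let (A_i)_{i∈I}, (B_i)_{i∈I} be families of subcomplexes of X and Y respectively such that: X = ⋃ A_i and Y = ⋃ B_i; every nonempty intersection of finitely many A_i's (resp. B_i's) is contractible; for every J ⊆ I, ⋂_{i∈J} A_i ≠ ∅ if and only if ⋂_{i∈J} B_i ≠ ∅; and f(A_i) ⊆ B_i for all i. Then f is a homotopy equivalence. -/
open Geometry

section

open Set Filter Topology

/-- `K` is a cone over its subset `L` with apex `p`: the depth function `t` vanishes exactly on `L`,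
and scaling `K` away from `p` by `(1 - s)⁻¹` with `s ≤ t z` keeps `z` inside `K`
while rescaling its depth affinely. -/
structure IsConeOver {V : Type*} [AddCommGroup V] [Module ℝ V] [TopologicalSpace V]
    (K L : Set V) (p : V) (t : V → ℝ) : Prop where
  subset : L ⊆ K
  continuousOn : ContinuousOn t K
  nonneg : ∀ z ∈ K, 0 ≤ t z
  le_one : ∀ z ∈ K, t z ≤ 1
  eq_zero_iff : ∀ z ∈ K, t z = 0 ↔ z ∈ L
  expand_mem : ∀ z ∈ K, ∀ s, 0 ≤ s → s ≤ t z → s < 1 → (1 - s)⁻¹ • (z - s • p) ∈ K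
  depth_expand : ∀ z ∈ K, ∀ s, 0 ≤ s → s ≤ t z → s < 1 →
    t ((1 - s)⁻¹ • (z - s • p)) = (1 - s)⁻¹ * (t z - s)

theorem isConeOver_singleton_zero : IsConeOver {(0 : ℝ)} ∅ 0 (fun _ ↦ 1) where
  subset := by simp
  continuousOn := continuousOn_const
  nonneg := by simp
  le_one := by simp
  eq_zero_iff := by simp
  expand_mem := by simp
  depth_expand := fun z _ s _ _ h ↦ (inv_mul_cancel₀ (by linarith)).symm

theorem isConeOver_Icc :
    IsConeOver (Icc (0 : ℝ) 1) {0, 1} (1 / 2) (fun x ↦ min (2 * x) (2 * (1 - x))) where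
  subset := by
    rintro x (rfl | rfl) <;> simp
  continuousOn := by fun_prop
  nonneg := fun x hx ↦ le_min (by linarith [hx.1]) (by linarith [hx.2])
  le_one := fun x hx ↦ by
    rcases le_total x (1 / 2) with h | h
    · exact (min_le_left _ _).trans (by linarith)
    · exact (min_le_right _ _).trans (by linarith)
  eq_zero_iff := fun x hx ↦ by
    constructor
    · intro h
      rcases min_choice (2 * x) (2 * (1 - x)) with h' | h' <;> rw [h'] at h
      · left; linarith
      · right; simp only [mem_singleton_iff]; linarith
    · rintro (rfl | rfl) <;> norm_num
  expand_mem := fun x hx s hs hst hs1 ↦ by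
    have h1 := hst.trans (min_le_left _ _)
    have h2 := hst.trans (min_le_right _ _)
    have h3 : 0 < 1 - s := by linarith
    simp only [smul_eq_mul, inv_mul_eq_div, mem_Icc]
    rw [le_div_iff₀ h3, div_le_iff₀ h3]
    constructor <;> linarith
  depth_expand := fun x hx s hs hst hs1 ↦ by
    have h3 : 0 < 1 - s := by linarith
    have h4 : (1 - s)⁻¹ * (1 - s) = 1 := inv_mul_cancel₀ h3.ne'
    rw [← min_sub_sub_right, mul_min_of_nonneg _ _ (inv_nonneg.2 h3.le)]
    simp only [smul_eq_mul]
    congr 1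
    · ring
    · linear_combination (-2) * h4

theorem IsConeOver.prod {V W : Type*} [AddCommGroup V] [Module ℝ V] [TopologicalSpace V]
    [AddCommGroup W] [Module ℝ W] [TopologicalSpace W]
    {K L : Set V} {p : V} {t : V → ℝ} {K' L' : Set W} {p' : W} {t' : W → ℝ}
    (h : IsConeOver K L p t) (h' : IsConeOver K' L' p' t') :
    IsConeOver (K ×ˢ K') (L ×ˢ K' ∪ K ×ˢ L') (p, p') (fun z ↦ min (t z.1) (t' z.2)) where
  subset := union_subset (prod_mono_left h.subset) (prod_mono_right h'.subset)
  continuousOn := (h.continuousOn.comp continuousOn_fst fun z hz ↦ hz.1).inf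
    (h'.continuousOn.comp continuousOn_snd fun z hz ↦ hz.2)
  nonneg := fun z hz ↦ le_min (h.nonneg _ hz.1) (h'.nonneg _ hz.2)
  le_one := fun z hz ↦ (min_le_left _ _).trans (h.le_one _ hz.1)
  eq_zero_iff := fun z hz ↦ by
    have h1 := h.eq_zero_iff _ hz.1
    have h2 := h'.eq_zero_iff _ hz.2
    have h3 := h.nonneg _ hz.1
    have h4 := h'.nonneg _ hz.2
    simp only [mem_union, mem_prod, hz.1, hz.2, true_and, and_true, ← h1, ← h2]
    constructor
    · intro h
      rcases min_choice (t z.1) (t' z.2) with h' | h' <;> rw [h'] at h <;> simp [h]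
    · rintro (h | h) <;> simp [h, h3, h4]
  expand_mem := fun z hz s hs hst hs1 ↦
    ⟨h.expand_mem _ hz.1 s hs (hst.trans (min_le_left _ _)) hs1,
      h'.expand_mem _ hz.2 s hs (hst.trans (min_le_right _ _)) hs1⟩
  depth_expand := fun z hz s hs hst hs1 ↦ by
    rw [← min_sub_sub_right, mul_min_of_nonneg _ _ (inv_nonneg.2 (by linarith)),
      ← h.depth_expand _ hz.1 s hs (hst.trans (min_le_left _ _)) hs1,
      ← h'.depth_expand _ hz.2 s hs (hst.trans (min_le_right _ _)) hs1]
    rfl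

theorem exists_contraction {Z : Type*} [TopologicalSpace Z] (C : Set Z) [ContractibleSpace C] :
    ∃ c ∈ C, ∃ h : Z → ℝ → Z, ContinuousOn (fun q : Z × ℝ ↦ h q.1 q.2) (C ×ˢ univ) ∧
      (∀ y ∈ C, ∀ s, h y s ∈ C) ∧ (∀ y ∈ C, h y 0 = y) ∧ ∀ y ∈ C, h y 1 = c := by
  classical
  obtain ⟨c, ⟨H⟩⟩ := id_nullhomotopic C
  refine ⟨c, c.2, fun y s ↦ if hy : y ∈ C then H (projIcc 0 1 zero_le_one s, ⟨y, hy⟩) else c,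
    ?_, fun y hy s ↦ by simp [hy], fun y hy ↦ by simp [hy], fun y hy ↦ by simp [hy]⟩
  rw [continuousOn_iff_continuous_domRestrict]
  have : Continuous fun q : (C ×ˢ (univ : Set ℝ) : Set (Z × ℝ)) ↦
      ((H (projIcc 0 1 zero_le_one q.1.2, ⟨q.1.1, q.2.1⟩) : C) : Z) := by
    refine continuous_subtype_val.comp (H.continuous.comp (Continuous.prodMk ?_ ?_))
    · exact continuous_projIcc.comp (by fun_prop)
    · exact Continuous.subtype_mk (by fun_prop) _
  convert! this using 2 with q
  simp [Set.domRestrict, q.2.1]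

/-- A continuous map from the base of a compact cone to a contractible set extends to the cone. -/
theorem IsConeOver.exists_extension {V Z : Type*} [AddCommGroup V] [Module ℝ V]
    [TopologicalSpace V] [IsTopologicalAddGroup V] [ContinuousSMul ℝ V] [TopologicalSpace Z]
    {K L : Set V} {p : V} {t : V → ℝ}
    (hK : IsConeOver K L p t) (hL : IsCompact L) {C : Set Z} [ContractibleSpace C]
    {g : V → Z} (hg : ContinuousOn g L) (hgC : MapsTo g L C) :
    ∃ G : V → Z, ContinuousOn G K ∧ EqOn G g L ∧ MapsTo G K C := by
  obtain ⟨c, hc, h, hcont, hmem, h0, h1⟩ := exists_contraction C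
  set r : V → V := fun z ↦ (1 - t z)⁻¹ • (z - t z • p) with hr
  have hrL : ∀ z ∈ K, t z < 1 → r z ∈ L := fun z hz hz1 ↦ by
    have h2 := hK.expand_mem z hz _ (hK.nonneg z hz) le_rfl hz1
    rw [← hK.eq_zero_iff _ h2, hK.depth_expand z hz _ (hK.nonneg z hz) le_rfl hz1]
    simp
  refine ⟨fun z ↦ if t z < 1 then h (g (r z)) (t z) else c, ?_, ?_, ?_⟩
  · intro z hz
    rcases (hK.le_one z hz).lt_or_eq with hz1 | hz1
    · set U : Set V := {w ∈ K | t w < 1}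
      have hU : U ∈ 𝓝[K] z :=
        inter_mem self_mem_nhdsWithin ((hK.continuousOn z hz).eventually_lt_const hz1)
      have htU : ContinuousOn t U := hK.continuousOn.mono fun w hw ↦ hw.1
      have hrU : ContinuousOn r U :=
        ((continuousOn_const.sub htU).inv₀ fun w hw ↦ (sub_pos.2 hw.2).ne').smul
          (continuousOn_id.sub (htU.smul continuousOn_const))
      have hGU : ContinuousOn (fun w ↦ h (g (r w)) (t w)) U :=
        hcont.comp ((hg.comp hrU fun w hw ↦ hrL w hw.1 hw.2).prodMk htU)
          fun w hw ↦ ⟨hgC (hrL w hw.1 hw.2), mem_univ _⟩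
      refine ContinuousWithinAt.mono_of_mem_nhdsWithin ?_ hU
      exact (hGU z ⟨hz, hz1⟩).congr (fun w hw ↦ if_pos hw.2) (if_pos hz1)
    · have hval : (if t z < 1 then h (g (r z)) (t z) else c) = c := if_neg hz1.not_lt
      unfold ContinuousWithinAt
      beta_reduce
      rw [hval]
      intro N hN
      have hLc : CompactSpace L := isCompact_iff_compactSpace.1 hL
      have hk : Continuous fun q : ℝ × L ↦ h (g q.2) q.1 := by
        refine hcont.comp_continuous (f := fun q : ℝ × L ↦ (g q.2, q.1)) ?_
          fun q ↦ ⟨hgC q.2.2, mem_univ _⟩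
        exact (hg.domRestrict.comp continuous_snd).prodMk continuous_fst
      have hev : ∀ᶠ s in 𝓝 (1 : ℝ), ∀ y ∈ (univ : Set L), h (g y) s ∈ N := by
        refine isCompact_univ.eventually_forall_of_forall_eventually
          (P := fun s (y : L) ↦ h (g y) s ∈ N) fun y _ ↦ ?_
        have := hk.tendsto (1, y)
        simp only [h1 _ (hgC y.2)] at this
        exact this hN
      have hev' := Tendsto.eventually (hz1 ▸ (hK.continuousOn z hz).tendsto) hev
      rw [mem_map]
      filter_upwards [hev', self_mem_nhdsWithin] with w hw hwK
      simp only [mem_preimage]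
      split_ifs with hw1
      · exact hw ⟨r w, hrL w hwK hw1⟩ (mem_univ _)
      · exact mem_of_mem_nhds hN
  · intro z hz
    have hz0 := (hK.eq_zero_iff z (hK.subset hz)).2 hz
    simp [hr, hz0, h0 _ (hgC hz)]
  · intro z hz
    dsimp only
    split_ifs with hz1
    · exact hmem _ (hgC (hrL z hz hz1)) _
    · exact hc

theorem AffineIndependent.exists_continuous_coord {E : Type*} [NormedAddCommGroup E]
    [NormedSpace ℝ E] {σ : Finset E} (hσ : AffineIndependent ℝ ((↑) : σ → E)) {v : E}
    (hv : v ∈ σ) :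
    ∃ b : E → ℝ, Continuous b ∧
      ∀ c : E → ℝ, ∑ w ∈ σ, c w = 1 → b (∑ w ∈ σ, c w • w) = c v := by
  classical
  have hlin := (affineIndependent_iff_linearIndependent_vsub ℝ _ (⟨v, hv⟩ : σ)).1 hσ
  obtain ⟨l, hl⟩ := (SeparatingDual.dualMap_surjective_iff (R := ℝ)).2
    (linearIndependent_iff_injective_fintypeLinearCombination.1 hlin) (∑ i, LinearMap.proj i)
  have hl' : ∀ w ∈ σ, w ≠ v → l (w - v) = 1 := fun w hw hwv ↦ by
    have := LinearMap.congr_fun hl (Pi.single ⟨⟨w, hw⟩, fun h ↦ hwv (congrArg Subtype.val h)⟩ 1)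
    simpa [Fintype.linearCombination_apply_single, Pi.single_apply] using this
  refine ⟨fun x ↦ 1 - l (x - v), by fun_prop, fun c hc ↦ ?_⟩
  have h1 : ∑ w ∈ σ, c w • w - v = ∑ w ∈ σ, c w • (w - v) := by
    simp only [smul_sub, Finset.sum_sub_distrib, ← Finset.sum_smul, hc, one_smul]
  have h2 : ∑ w ∈ σ.erase v, c w * l (w - v) = ∑ w ∈ σ.erase v, c w :=
    Finset.sum_congr rfl fun w hw ↦ by
      rw [hl' w (Finset.mem_of_mem_erase hw) (Finset.ne_of_mem_erase hw), mul_one]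
  beta_reduce
  rw [h1, map_sum]
  simp only [map_smul, smul_eq_mul]
  rw [← Finset.add_sum_erase _ _ hv, h2, sub_self, map_zero, mul_zero, zero_add, ← hc,
    ← Finset.add_sum_erase _ _ hv, add_sub_cancel_right]

/-- A simplex is a cone over the union of its proper faces. -/
theorem AffineIndependent.exists_isConeOver {E : Type*} [NormedAddCommGroup E]
    [NormedSpace ℝ E] {σ : Finset E} (hσ : AffineIndependent ℝ ((↑) : σ → E))
    (hne : σ.Nonempty) :
    ∃ p t, IsConeOver (convexHull ℝ (σ : Set E)) (⋃ τ ∈ Iio σ, convexHull ℝ (τ : Set E))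
      p t := by
  classical
  choose! b hbc hb using fun v hv ↦ hσ.exists_continuous_coord (v := v) hv
  have hn : (0 : ℝ) < σ.card := by exact_mod_cast hne.card_pos
  set n : ℝ := (σ.card : ℝ)
  have hbp : ∀ c : E → ℝ, ∑ w ∈ σ, c w = 1 →
      σ.inf' hne (fun v ↦ n * b v (∑ w ∈ σ, c w • w)) = σ.inf' hne (fun v ↦ n * c v) :=
    fun c hc ↦ Finset.inf'_congr _ rfl fun v hv ↦ by rw [hb v hv c hc]
  have hexp : ∀ (c : E → ℝ) (s : ℝ), (1 - s)⁻¹ • (∑ w ∈ σ, c w • w - s • ∑ w ∈ σ, n⁻¹ • w) =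
      ∑ w ∈ σ, ((1 - s)⁻¹ * (c w - s * n⁻¹)) • w := fun c s ↦ by
    simp only [Finset.smul_sum, ← Finset.sum_sub_distrib, smul_smul, ← sub_smul]
  have hexp1 : ∀ (c : E → ℝ) (s : ℝ), s < 1 → ∑ w ∈ σ, c w = 1 →
      ∑ w ∈ σ, ((1 - s)⁻¹ * (c w - s * n⁻¹)) = 1 := fun c s hs hc ↦ by
    rw [← Finset.mul_sum, Finset.sum_sub_distrib, hc, Finset.sum_const, nsmul_eq_mul]
    rw [mul_left_comm, mul_inv_cancel₀ hn.ne', mul_one, inv_mul_cancel₀ (by linarith)]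
  refine ⟨∑ w ∈ σ, n⁻¹ • w, fun z ↦ σ.inf' hne fun v ↦ n * b v z, ?_, ?_, ?_, ?_, ?_, ?_, ?_⟩
  · refine Set.iUnion₂_subset fun τ hτ ↦ convexHull_mono ?_
    exact_mod_cast (mem_Iio.1 hτ).le
  · refine ContinuousOn.finset_inf'_apply hne fun v hv ↦ ?_
    exact (continuous_const.mul (hbc v hv)).continuousOn
  · intro z hz
    obtain ⟨c, hc0, hc1, rfl⟩ := Finset.mem_convexHull'.1 hz
    rw [hbp c hc1]
    exact Finset.le_inf' _ _ fun v hv ↦ mul_nonneg hn.le (hc0 v hv)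
  · intro z hz
    obtain ⟨c, hc0, hc1, rfl⟩ := Finset.mem_convexHull'.1 hz
    rw [hbp c hc1]
    obtain ⟨v, hv, hcv⟩ := Finset.exists_le_of_sum_le (f := c) (g := fun _ ↦ n⁻¹) hne
      (by rw [hc1, Finset.sum_const, nsmul_eq_mul, mul_inv_cancel₀ hn.ne'])
    refine (Finset.inf'_le _ hv).trans ?_
    calc n * c v ≤ n * n⁻¹ := by gcongr
      _ = 1 := mul_inv_cancel₀ hn.ne'
  · intro z hz
    simp only [mem_iUnion, mem_Iio, exists_prop]
    constructor
    · obtain ⟨c, hc0, hc1, rfl⟩ := Finset.mem_convexHull'.1 hz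
      rw [hbp c hc1]
      intro h
      obtain ⟨v, hv, hcv⟩ := Finset.exists_mem_eq_inf' hne (fun v ↦ n * c v)
      rw [h, eq_comm, mul_eq_zero, or_iff_right hn.ne'] at hcv
      refine ⟨σ.erase v, Finset.erase_ssubset hv, Finset.mem_convexHull'.2 ⟨c,
        fun w hw ↦ hc0 w (Finset.mem_of_mem_erase hw), ?_, ?_⟩⟩
      · rw [Finset.sum_erase _ hcv, hc1]
      · exact Finset.sum_erase _ (by rw [hcv, zero_smul])
    · rintro ⟨τ, hτ, hzτ⟩
      obtain ⟨c, hc0, hc1, rfl⟩ := Finset.mem_convexHull'.1 hzτ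
      obtain ⟨v, hv, hvτ⟩ := Finset.exists_of_ssubset hτ
      have hind : ∑ w ∈ σ, (if w ∈ τ then c w else 0) = 1 := by
        rw [← hc1, Finset.sum_ite_mem, Finset.inter_eq_right.2 hτ.subset]
      have hind' : ∑ w ∈ τ, c w • w = ∑ w ∈ σ, (if w ∈ τ then c w else 0) • w := by
        simp only [ite_smul, zero_smul]
        rw [Finset.sum_ite_mem, Finset.inter_eq_right.2 hτ.subset]
      rw [hind', hbp _ hind]
      refine le_antisymm ((Finset.inf'_le _ hv).trans (by simp [hvτ])) ?_
      refine Finset.le_inf' _ _ fun w _ ↦ mul_nonneg hn.le ?_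
      split_ifs with hw
      exacts [hc0 w hw, le_rfl]
  · intro z hz s hs hst hs1
    obtain ⟨c, hc0, hc1, rfl⟩ := Finset.mem_convexHull'.1 hz
    rw [hbp c hc1, Finset.le_inf'_iff] at hst
    rw [hexp]
    refine Finset.mem_convexHull'.2 ⟨_, fun w hw ↦ ?_, hexp1 c s hs1 hc1, rfl⟩
    refine mul_nonneg (inv_nonneg.2 (by linarith)) (sub_nonneg.2 ?_)
    rw [← div_eq_mul_inv, div_le_iff₀ hn, mul_comm]
    exact hst w hw
  · intro z hz s hs hst hs1
    obtain ⟨c, hc0, hc1, rfl⟩ := Finset.mem_convexHull'.1 hz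
    have h0 : 0 < 1 - s := by linarith
    rw [hexp, hbp _ (hexp1 c s hs1 hc1), hbp c hc1]
    have hmono : Monotone fun x : ℝ ↦ (1 - s)⁻¹ * (x - s) := fun x y hxy ↦
      mul_le_mul_of_nonneg_left (by linarith) (inv_nonneg.2 h0.le)
    rw [Finset.apply_inf'_eq_inf'_comp hne (fun x : ℝ ↦ (1 - s)⁻¹ * (x - s))
      (fun x y ↦ hmono.map_min)]
    refine Finset.inf'_congr _ rfl fun v _ ↦ ?_
    have : n * n⁻¹ = 1 := mul_inv_cancel₀ hn.ne'
    simp only [Function.comp]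
    linear_combination (-(1 - s)⁻¹ * s) * this

namespace Geometry.SimplicialComplex

theorem isCompact_space {E : Type*} [NormedAddCommGroup E] [NormedSpace ℝ E]
    {X : SimplicialComplex ℝ E} (hX : X.faces.Finite) : IsCompact X.space :=
  hX.isCompact_biUnion fun s _ ↦ s.finite_toSet.isCompact_convexHull ℝ

/-- A proper intersection of two simplices of a complex lies in the boundary of the first one. -/
theorem mem_convexHull_ssubset {E : Type*} [AddCommGroup E] [Module ℝ E]
    {X : SimplicialComplex ℝ E} {σ τ : Finset E} (hσ : σ ∈ X.faces) (hτ : τ ∈ X.faces)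
    (h : ¬ σ ⊆ τ) {x : E} (hxσ : x ∈ convexHull ℝ (σ : Set E))
    (hxτ : x ∈ convexHull ℝ (τ : Set E)) :
    x ∈ ⋃ ρ ∈ Iio σ, convexHull ℝ (ρ : Set E) := by
  classical
  have := X.inter_subset_convexHull hσ hτ ⟨hxσ, hxτ⟩
  rw [← Finset.coe_inter] at this
  refine mem_iUnion₂.2 ⟨σ ∩ τ, mem_Iio.2 ?_, this⟩
  exact Finset.inter_subset_left.ssubset_of_ne fun h' ↦ h (Finset.inter_eq_left.1 h')

/-- Acyclic carrier extension: a map prescribed on `X.space ×ˢ T₀` and compatible with a monotone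
family of contractible carriers extends to `X.space ×ˢ T`, if `T` is a cone over `T₀`. -/
theorem exists_extension_of_carrier {E Z : Type*} [NormedAddCommGroup E] [NormedSpace ℝ E]
    [TopologicalSpace Z] {X : SimplicialComplex ℝ E} (hX : X.faces.Finite)
    {T T₀ : Set ℝ} {q : ℝ} {u : ℝ → ℝ} (hT : IsConeOver T T₀ q u) (hTc : IsCompact T)
    (hT₀ : IsCompact T₀) (Φ : Finset E → Set Z)
    (hΦ : ∀ σ ∈ X.faces, ContractibleSpace (Φ σ))
    (hmono : ∀ σ ∈ X.faces, ∀ τ ∈ X.faces, τ ⊆ σ → Φ τ ⊆ Φ σ)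
    {g : E × ℝ → Z} (hg : ContinuousOn g (X.space ×ˢ T₀))
    (hgΦ : ∀ σ ∈ X.faces, MapsTo g (convexHull ℝ (σ : Set E) ×ˢ T₀) (Φ σ)) :
    ∃ G : E × ℝ → Z, ContinuousOn G (X.space ×ˢ T) ∧ EqOn G g (X.space ×ˢ T₀) ∧
      ∀ σ ∈ X.faces, MapsTo G (convexHull ℝ (σ : Set E) ×ˢ T) (Φ σ) := by
  classical
  have hcpt (σ : Finset E) : IsCompact (convexHull ℝ (σ : Set E)) :=
    σ.finite_toSet.isCompact_convexHull ℝ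
  have hbase : IsClosed (X.space ×ˢ T₀) := ((isCompact_space hX).prod hT₀).isClosed
  suffices H : ∀ S : Finset (Finset E), ↑S ⊆ X.faces →
      (∀ σ ∈ S, ∀ τ ∈ X.faces, τ ⊆ σ → τ ∈ S) →
      ∃ G : E × ℝ → Z,
        ContinuousOn G ((⋃ σ ∈ S, convexHull ℝ (σ : Set E)) ×ˢ T ∪ X.space ×ˢ T₀) ∧
        EqOn G g (X.space ×ˢ T₀) ∧
        ∀ σ ∈ S, MapsTo G (convexHull ℝ (σ : Set E) ×ˢ T) (Φ σ) by
    obtain ⟨G, hG, hGg, hGΦ⟩ := H hX.toFinset (by simp) (by simp +contextual)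
    simp only [Finite.mem_toFinset] at hG hGΦ
    exact ⟨G, hG.mono subset_union_left, hGg, hGΦ⟩
  intro S
  refine Finset.induction_on_max_value Finset.card S ?_ ?_
  · exact fun _ _ ↦ ⟨g, by simpa using hg, fun _ _ ↦ rfl, by simp⟩
  · intro σ S hσS hcard ih hsub hlower
    have hσ : σ ∈ X.faces := hsub (by simp)
    have hS : ↑S ⊆ X.faces := fun τ hτ ↦ hsub (by simp [Finset.mem_coe.1 hτ])
    have hnsub : ∀ τ ∈ S, ¬ σ ⊆ τ := fun τ hτ h ↦
      hσS (Finset.eq_of_subset_of_card_le h (hcard τ hτ) ▸ hτ)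
    have hproper : ∀ τ ⊂ σ, τ.Nonempty → τ ∈ S := fun τ hτ hne ↦
      (Finset.mem_insert.1 (hlower σ (by simp) τ (X.down_closed hσ hτ.subset hne)
        hτ.subset)).resolve_left hτ.ne
    obtain ⟨G, hG, hGg, hGΦ⟩ := ih hS fun τ hτ ρ hρ hρτ ↦
      (Finset.mem_insert.1 (hlower τ (by simp [hτ]) ρ hρ hρτ)).resolve_left
        fun h ↦ hnsub τ hτ (h ▸ hρτ)
    obtain ⟨p, t, hcone⟩ := (X.indep hσ).exists_isConeOver (nonempty_of_mem_faces hσ)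
    set D : Set E := ⋃ τ ∈ Iio σ, convexHull ℝ (τ : Set E)
    set W : Set (E × ℝ) := (⋃ σ ∈ S, convexHull ℝ (σ : Set E)) ×ˢ T ∪ X.space ×ˢ T₀
    set K : Set (E × ℝ) := convexHull ℝ (σ : Set E) ×ˢ T
    have hKT := hcone.prod hT
    set L : Set (E × ℝ) := D ×ˢ T ∪ convexHull ℝ (σ : Set E) ×ˢ T₀
    have hbdc : IsCompact D := (finite_Iio σ).isCompact_biUnion fun τ _ ↦ hcpt τ
    have hLc : IsCompact L := (hbdc.prod hTc).union ((hcpt σ).prod hT₀)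
    have hbdS : ∀ x ∈ D, ∃ τ ∈ S, τ ⊆ σ ∧ x ∈ convexHull ℝ (τ : Set E) := fun x hx ↦ by
      obtain ⟨τ, hτ, hxτ⟩ := mem_iUnion₂.1 hx
      have hτσ : τ ⊂ σ := mem_Iio.1 hτ
      refine ⟨τ, hproper τ hτσ ?_, hτσ.subset, hxτ⟩
      exact Finset.coe_nonempty.1 (convexHull_nonempty_iff.1 ⟨x, hxτ⟩)
    have hLW : L ⊆ W := by
      rintro ⟨x, s⟩ (⟨hx, hs⟩ | ⟨hx, hs⟩)
      · obtain ⟨τ, hτ, -, hxτ⟩ := hbdS x hx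
        exact Or.inl ⟨mem_iUnion₂.2 ⟨τ, hτ, hxτ⟩, hs⟩
      · exact Or.inr ⟨convexHull_subset_space hσ hx, hs⟩
    have hKW : K ∩ W ⊆ L := by
      rintro ⟨x, s⟩ ⟨⟨hx, hs⟩, ⟨hx', -⟩ | ⟨-, hs'⟩⟩
      · obtain ⟨τ, hτ, hxτ⟩ := mem_iUnion₂.1 hx'
        exact Or.inl ⟨mem_convexHull_ssubset hσ (hS hτ) (hnsub τ hτ) hx hxτ, hs⟩
      · exact Or.inr ⟨hx, hs'⟩
    have hGL : MapsTo G L (Φ σ) := by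
      rintro ⟨x, s⟩ (⟨hx, hs⟩ | ⟨hx, hs⟩)
      · obtain ⟨τ, hτ, hτσ, hxτ⟩ := hbdS x hx
        exact hmono σ hσ τ (hS hτ) hτσ (hGΦ τ hτ ⟨hxτ, hs⟩)
      · rw [hGg ⟨convexHull_subset_space hσ hx, hs⟩]
        exact hgΦ σ hσ ⟨hx, hs⟩
    have := hΦ σ hσ
    obtain ⟨G', hG', hG'G, hG'Φ⟩ := hKT.exists_extension hLc (hG.mono hLW) hGL
    have hpW : EqOn (K.piecewise G' G) G W := fun z hz ↦ by
      by_cases hzK : z ∈ K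
      · rw [piecewise_eq_of_mem _ _ _ hzK, hG'G (hKW ⟨hzK, hz⟩)]
      · rw [piecewise_eq_of_notMem _ _ _ hzK]
    have hpK : EqOn (K.piecewise G' G) G' K := piecewise_eqOn _ _ _
    have hWc : IsClosed W := IsClosed.union
      (((S.finite_toSet.isCompact_biUnion fun τ _ ↦ hcpt τ).prod hTc).isClosed) hbase
    refine ⟨K.piecewise G' G, ?_, ?_, ?_⟩
    · have := (hG'.congr hpK).union_of_isClosed (hG.congr hpW) ((hcpt σ).prod hTc).isClosed hWc
      refine this.mono ?_
      rw [Finset.set_biUnion_insert, union_prod, union_assoc]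
    · exact fun z hz ↦ (hpW (Or.inr hz)).trans (hGg hz)
    · intro τ hτ
      rcases Finset.mem_insert.1 hτ with rfl | hτ
      · exact hG'Φ.congr hpK.symm
      · refine (hGΦ τ hτ).congr fun z hz ↦ (hpW (Or.inl ⟨?_, hz.2⟩)).symm
        exact mem_iUnion₂.2 ⟨τ, hτ, hz.1⟩

/-- Version of `exists_extension_of_carrier` where the carriers are the intersections of a family
of sets indexed like a family of subcomplexes. -/
theorem exists_extension_of_subcomplexes {E Z I : Type*} [NormedAddCommGroup E]
    [NormedSpace ℝ E] [TopologicalSpace Z] {X : SimplicialComplex ℝ E} (hX : X.faces.Finite)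
    {T T₀ : Set ℝ} {q : ℝ} {u : ℝ → ℝ} (hT : IsConeOver T T₀ q u) (hTc : IsCompact T)
    (hT₀ : IsCompact T₀) {A : I → SimplicialComplex ℝ E} (hA : ∀ i, (A i).faces ⊆ X.faces)
    {C : I → Set Z} (hC : ∀ J : Set I, (⋂ i ∈ J, (A i).space).Nonempty →
      ContractibleSpace (⋂ i ∈ J, C i))
    {g : E × ℝ → Z} (hg : ContinuousOn g (X.space ×ˢ T₀))
    (hgC : ∀ i, MapsTo g ((A i).space ×ˢ T₀) (C i)) :
    ∃ G : E × ℝ → Z, ContinuousOn G (X.space ×ˢ T) ∧ EqOn G g (X.space ×ˢ T₀) ∧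
      ∀ i, MapsTo G ((A i).space ×ˢ T) (C i) := by
  obtain ⟨G, hG, hGg, hGΦ⟩ := exists_extension_of_carrier hX hT hTc hT₀
    (fun σ ↦ ⋂ i ∈ {i | σ ∈ (A i).faces}, C i)
    (fun σ hσ ↦ by
      obtain ⟨v, hv⟩ := nonempty_of_mem_faces hσ
      exact hC _ ⟨v, mem_iInter₂.2 fun i hi ↦ (A i).subset_space hi hv⟩)
    (fun σ _ τ hτ hτσ ↦ biInter_subset_biInter_left fun i hi ↦
      (A i).down_closed hi hτσ (nonempty_of_mem_faces hτ))
    hg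
    (fun σ _ z hz ↦ mem_iInter₂.2 fun i hi ↦ hgC i ⟨convexHull_subset_space hi hz.1, hz.2⟩)
  refine ⟨G, hG, hGg, fun i z hz ↦ ?_⟩
  obtain ⟨σ, hσ, hzσ⟩ := mem_space_iff.1 hz.1
  exact mem_iInter₂.1 (hGΦ σ (hA i hσ) ⟨hzσ, hz.2⟩) i hσ

/-- Two self-maps preserving all members of a cover by subcomplexes with contractible
intersections are homotopic. -/
theorem homotopic_of_mapsTo {E I : Type*} [NormedAddCommGroup E] [NormedSpace ℝ E]
    {X : SimplicialComplex ℝ E} (hX : X.faces.Finite)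
    {A : I → SimplicialComplex ℝ E} (hA : ∀ i, (A i).faces ⊆ X.faces)
    (hcover : X.space = ⋃ i, (A i).space)
    (hC : ∀ J : Set I, (⋂ i ∈ J, (A i).space).Nonempty →
      ContractibleSpace (⋂ i ∈ J, (A i).space))
    (g₀ g₁ : C(X.space, X.space))
    (h₀ : ∀ i, ∀ x : X.space, (x : E) ∈ (A i).space → (g₀ x : E) ∈ (A i).space)
    (h₁ : ∀ i, ∀ x : X.space, (x : E) ∈ (A i).space → (g₁ x : E) ∈ (A i).space) :
    g₀.Homotopic g₁ := by
  classical
  have hsub (i : I) : (A i).space ⊆ X.space := hcover ▸ subset_iUnion (fun i ↦ (A i).space) i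
  set g : E × ℝ → E := fun z ↦ if hz : z.1 ∈ X.space then
    if z.2 = 0 then (g₀ ⟨z.1, hz⟩ : E) else g₁ ⟨z.1, hz⟩ else 0
  have hg0 (x : X.space) : g (x, 0) = g₀ x := by simp [g]
  have hg1 (x : X.space) : g (x, 1) = g₁ x := by simp [g]
  have hpair : X.space ×ˢ ({0, 1} : Set ℝ) = X.space ×ˢ {0} ∪ X.space ×ˢ {1} := by
    rw [← prod_union, singleton_union]
  have hXc := (isCompact_space hX).isClosed
  have hcont {k : C(X.space, X.space)} {s : ℝ} (hk : ∀ x : X.space, g (x, s) = k x) :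
      ContinuousOn g (X.space ×ˢ {s}) := by
    rw [continuousOn_iff_continuous_domRestrict]
    have : Continuous fun z : (X.space ×ˢ {s} : Set (E × ℝ)) ↦ (k ⟨z.1.1, z.2.1⟩ : E) :=
      continuous_subtype_val.comp (k.continuous.comp (Continuous.subtype_mk (by fun_prop) _))
    convert! this using 2 with z
    obtain ⟨⟨x, s'⟩, hx, rfl⟩ := z
    exact hk ⟨x, hx⟩
  obtain ⟨G, hG, hGg, hGA⟩ := exists_extension_of_subcomplexes hX isConeOver_Icc isCompact_Icc
    (Set.toFinite {0, 1}).isCompact hA hC (g := g)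
    (hpair ▸ (hcont hg0).union_of_isClosed (hcont hg1) (hXc.prod isClosed_singleton)
      (hXc.prod isClosed_singleton))
    (by
      rintro i ⟨x, s⟩ ⟨hx, rfl | rfl⟩
      · exact hg0 ⟨x, hsub i hx⟩ ▸ h₀ i ⟨x, hsub i hx⟩ hx
      · exact hg1 ⟨x, hsub i hx⟩ ▸ h₁ i ⟨x, hsub i hx⟩ hx)
  have hGX : ∀ (s : unitInterval) (x : X.space), G (x, s) ∈ X.space := fun s x ↦ by
    obtain ⟨i, hi⟩ := mem_iUnion.1 (hcover.subset x.2)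
    exact hsub i (hGA i ⟨hi, s.2⟩)
  refine ⟨⟨⟨fun z ↦ ⟨G (z.2, z.1), hGX z.1 z.2⟩, ?_⟩, fun x ↦ ?_, fun x ↦ ?_⟩⟩
  · refine Continuous.subtype_mk (hG.comp_continuous (by fun_prop) fun z ↦ ⟨z.2.2, z.1.2⟩) _
  · exact Subtype.ext ((hGg ⟨x.2, by simp⟩).trans (hg0 x))
  · exact Subtype.ext ((hGg ⟨x.2, by simp⟩).trans (hg1 x))

end Geometry.SimplicialComplex

end

/-- A carrier-type lemma: let `f : X → Y` be (the realization of) a simplicial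
map of finite simplicial complexes, and let `(A i)`, `(B i)` be families of
subcomplexes covering `X` resp. `Y`, all of whose nonempty intersections are
contractible, such that a family of `A i`'s has nonempty intersection iff the
corresponding `B i`'s do, and `f (A i) ⊆ B i` for all `i`. Then `f` is a
homotopy equivalence. -/
theorem homotopyEquiv_of_carriers
    {E F : Type*} [NormedAddCommGroup E] [NormedSpace ℝ E]
    [NormedAddCommGroup F] [NormedSpace ℝ F] [DecidableEq F]
    (X : SimplicialComplex ℝ E) (Y : SimplicialComplex ℝ F)
    (hX : X.faces.Finite) (hY : Y.faces.Finite)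
    (f : C(X.space, Y.space))
    -- `f` is simplicial: it is induced by a vertex map sending faces to faces,
    -- and it maps each closed simplex of `X` into the corresponding simplex of `Y`
    (φ : E → F) (hφ : ∀ s ∈ X.faces, s.image φ ∈ Y.faces)
    (hfφ : ∀ s ∈ X.faces, ∀ x : X.space, (x : E) ∈ convexHull ℝ (s : Set E) →
      (f x : F) ∈ convexHull ℝ ((s.image φ : Finset F) : Set F))
    {I : Type*} (A : I → SimplicialComplex ℝ E) (B : I → SimplicialComplex ℝ F)
    (hAsub : ∀ i, (A i).faces ⊆ X.faces) (hBsub : ∀ i, (B i).faces ⊆ Y.faces)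
    (hAcover : X.space = ⋃ i, (A i).space) (hBcover : Y.space = ⋃ i, (B i).space)
    (hAcontr : ∀ J : Set I, (⋂ i ∈ J, (A i).space).Nonempty →
      ContractibleSpace (⋂ i ∈ J, (A i).space))
    (hBcontr : ∀ J : Set I, (⋂ i ∈ J, (B i).space).Nonempty →
      ContractibleSpace (⋂ i ∈ J, (B i).space))
    (hnerve : ∀ J : Set I, (⋂ i ∈ J, (A i).space).Nonempty ↔
      (⋂ i ∈ J, (B i).space).Nonempty)
    (hfA : ∀ i, ∀ x : X.space, (x : E) ∈ (A i).space → (f x : F) ∈ (B i).space) :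
    ∃ h : ContinuousMap.HomotopyEquiv X.space Y.space, h.toFun = f := by
  have hAX (i : I) : (A i).space ⊆ X.space :=
    hAcover ▸ Set.subset_iUnion (fun i ↦ (A i).space) i
  obtain ⟨G, hG, -, hGA⟩ := SimplicialComplex.exists_extension_of_subcomplexes hY
    isConeOver_singleton_zero isCompact_singleton isCompact_empty hBsub
    (fun J hJ ↦ hAcontr J ((hnerve J).2 hJ)) (g := fun _ ↦ (0 : E)) (by simp) (by simp [Set.MapsTo])
  have hGA' (i : I) (y : F) (hy : y ∈ (B i).space) : G (y, 0) ∈ (A i).space := hGA i ⟨hy, rfl⟩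
  have hGX (y : Y.space) : G (y, 0) ∈ X.space := by
    obtain ⟨i, hi⟩ := Set.mem_iUnion.1 (hBcover.subset y.2)
    exact hAX i (hGA' i y hi)
  let g : C(Y.space, X.space) := ⟨fun y ↦ ⟨G (y, 0), hGX y⟩, Continuous.subtype_mk
    (hG.comp_continuous (by fun_prop) fun y ↦ ⟨y.2, Set.mem_singleton _⟩) _⟩
  refine ⟨⟨f, g, ?_, ?_⟩, rfl⟩
  · exact SimplicialComplex.homotopic_of_mapsTo hX hAsub hAcover hAcontr _ _
      (fun i x hx ↦ hGA' i _ (hfA i x hx)) fun i x hx ↦ hx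
  · exact SimplicialComplex.homotopic_of_mapsTo hY hBsub hBcover hBcontr _ _
      (fun i y hy ↦ hfA i (g y) (hGA' i y hy)) fun i y hy ↦ hy
end

section
/- Let M and N be matroids of the same rank r on the same ground set E, and suppose M ⤳ N is a weak map (the rank in M of every subset A ⊆ E is at least its rank in N). Given complete flags F in M and G in N... Specialize: let M be a rank r geometric lattice with two complete flags F = {F_0 < ⋯ < F_r} and G = {G_0 < ⋯ < G_r}. Then there exist coatoms C_0, …, C_{r−1} of M such that for all i ≠ j, C_i and C_j lie in different parts of the partition {A_0(F), …, A_{r−1}(F)} of the coatoms induced by F, and also in different parts of the partition induced by G. -/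
/-- A geometric lattice: a finite ranked lattice in which every element is a
join of atoms and the rank function is semimodular. -/
structure IsGeometricLattice (L : Type*) [Lattice L] [BoundedOrder L] [Finite L]
    (rk : L → ℕ) : Prop where
  rank_bot : rk ⊥ = 0
  rank_strictMono : StrictMono rk
  rank_covBy : ∀ x y : L, x ⋖ y → rk y = rk x + 1
  atomistic : ∀ x : L, ∃ s : Finset L, (∀ a ∈ s, IsAtom a) ∧ x = s.sup id
  semimodular : ∀ x y : L, rk (x ⊓ y) + rk (x ⊔ y) ≤ rk x + rk y

/-- The set of coatoms of `L` lying above `X`. -/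
def coatomsAbove {L : Type*} [Lattice L] [BoundedOrder L] (X : L) : Set L :=
  {C | IsCoatom C ∧ X ≤ C}

/-- A complete flag `⊥ = F 0 ⋖ F 1 ⋖ ⋯ ⋖ F r = ⊤` (a maximal chain) in a
rank `r` lattice, recorded as a sequence of covers. -/
def IsCompleteFlag {L : Type*} [Lattice L] [BoundedOrder L] {r : ℕ}
    (F : Fin (r + 1) → L) : Prop :=
  F 0 = ⊥ ∧ F (Fin.last r) = ⊤ ∧ ∀ i : Fin r, F i.castSucc ⋖ F i.succ

theorem IsGeometricLattice.rank_sup_le_of_covBy {L : Type*} [Lattice L] [BoundedOrder L] [Finite L]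
    {rk : L → ℕ} (hL : IsGeometricLattice L rk) {x y : L} (h : x ⋖ y) (z : L) :
    rk (y ⊔ z) ≤ rk (x ⊔ z) + 1 := by
  have hs := hL.semimodular (x ⊔ z) y
  have hc := hL.rank_covBy x y h
  have hm : rk x ≤ rk ((x ⊔ z) ⊓ y) :=
    hL.rank_strictMono.monotone (le_inf le_sup_left h.le)
  have he : (x ⊔ z) ⊔ y = y ⊔ z := by
    rw [sup_right_comm, sup_eq_right.mpr h.le]
  rw [he] at hs
  omega

theorem IsGeometricLattice.eq_of_le_of_rank_le {L : Type*} [Lattice L] [BoundedOrder L] [Finite L]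
    {rk : L → ℕ} (hL : IsGeometricLattice L rk) {x y : L} (h : x ≤ y) (hr : rk y ≤ rk x) :
    x = y := by
  by_contra hne
  exact absurd (hL.rank_strictMono (lt_of_le_of_ne h hne)) (not_lt.mpr hr)

theorem IsGeometricLattice.exists_isAtom_not_le {L : Type*} [Lattice L] [BoundedOrder L] [Finite L]
    {rk : L → ℕ} (hL : IsGeometricLattice L rk) {w : L} (hw : w ≠ ⊤) :
    ∃ p, IsAtom p ∧ ¬p ≤ w := by
  by_contra! h
  obtain ⟨s, hs, hst⟩ := hL.atomistic ⊤
  exact hw (top_le_iff.mp (hst.le.trans (Finset.sup_le fun a ha => h a (hs a ha))))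

theorem IsGeometricLattice.exists_isCoatom_not_le {L : Type*} [Lattice L] [BoundedOrder L]
    [Finite L] {rk : L → ℕ} (hL : IsGeometricLattice L rk) {x a : L} (h : ¬a ≤ x) :
    ∃ C, IsCoatom C ∧ x ≤ C ∧ ¬a ≤ C := by
  obtain ⟨y, hy⟩ := (Set.toFinite {y : L | x ≤ y ∧ ¬a ≤ y}).exists_maximal ⟨x, le_rfl, h⟩
  obtain ⟨hxy, hay⟩ := hy.prop
  have above {z : L} (hz : y < z) : y ⊔ a ≤ z :=
    sup_le hz.le <| by_contra fun haz => hy.not_prop_of_gt hz ⟨hxy.trans hz.le, haz⟩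
  have htop : y ⊔ a = ⊤ := by
    by_contra hne
    obtain ⟨p, hp, hpw⟩ := hL.exists_isAtom_not_le hne
    have hyp : y < p ⊔ y := right_lt_sup.mpr fun hle => hpw (hle.trans le_sup_left)
    have hle := hL.rank_sup_le_of_covBy (bot_covBy_iff.mpr hp) y
    rw [bot_sup_eq] at hle
    have hlt := hL.rank_strictMono (left_lt_sup.mpr hay)
    exact hpw ((hL.eq_of_le_of_rank_le (above hyp) (by omega)) ▸ le_sup_left)
  refine ⟨y, ⟨fun hy_top => hay (hy_top ▸ le_top), fun z hz => ?_⟩, hxy, hay⟩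
  exact top_le_iff.mp (htop ▸ above hz)

theorem IsCompleteFlag.monotone {L : Type*} [Lattice L] [BoundedOrder L] {r : ℕ}
    {F : Fin (r + 1) → L} (hF : IsCompleteFlag F) : Monotone F :=
  Fin.monotone_iff_le_succ.mpr fun i => (hF.2.2 i).le

theorem IsCompleteFlag.part_unique {L : Type*} [Lattice L] [BoundedOrder L] {r : ℕ}
    {F : Fin (r + 1) → L} (hF : IsCompleteFlag F) {C : L} {i j : Fin r}
    (hi : C ∈ coatomsAbove (F i.castSucc) \ coatomsAbove (F i.succ))
    (hj : C ∈ coatomsAbove (F j.castSucc) \ coatomsAbove (F j.succ)) : i = j := by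
  by_contra hne
  rcases lt_or_gt_of_ne hne with h | h
  · exact hi.2 ⟨hi.1.1, (hF.monotone (Fin.succ_le_castSucc_iff.mpr h)).trans hj.1.2⟩
  · exact hj.2 ⟨hi.1.1, (hF.monotone (Fin.succ_le_castSucc_iff.mpr h)).trans hi.1.2⟩

/-- The Jordan–Hölder index: the step of the flag `G` at which joining with `G` first identifies
`x` with its cover `y`. -/
theorem IsCompleteFlag.exists_sup_eq_step {L : Type*} [Lattice L] [BoundedOrder L] {r : ℕ}
    {G : Fin (r + 1) → L} (hG : IsCompleteFlag G) {x y : L} (h : x ⋖ y) :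
    ∃ j : Fin r, ¬y ≤ x ⊔ G j.castSucc ∧ y ≤ x ⊔ G j.succ := by
  by_contra! hstep
  have hall : ∀ j : Fin (r + 1), ¬y ≤ x ⊔ G j :=
    Fin.induction (by rw [hG.1, sup_bot_eq]; exact h.lt.not_ge) hstep
  exact hall (Fin.last r) (by rw [hG.2.1, sup_top_eq]; exact le_top)

/-- The Jordan–Hölder condition is symmetric in the two covers involved. -/
theorem IsGeometricLattice.le_sup_of_covBy {L : Type*} [Lattice L] [BoundedOrder L] [Finite L]
    {rk : L → ℕ} (hL : IsGeometricLattice L rk) {x y z w : L} (hzw : z ⋖ w)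
    (hn : ¬y ≤ x ⊔ z) (hle : y ≤ x ⊔ w) (hxy : x ≤ y) : w ≤ y ⊔ z := by
  have hub : y ⊔ z ≤ x ⊔ w := sup_le hle (hzw.le.trans le_sup_right)
  have hlt : rk (x ⊔ z) < rk (y ⊔ z) :=
    hL.rank_strictMono <| lt_of_le_not_ge (sup_le_sup_right hxy z) fun hge =>
      hn (le_sup_left.trans hge)
  have hrk := hL.rank_sup_le_of_covBy hzw x
  rw [sup_comm w x, sup_comm z x] at hrk
  exact (hL.eq_of_le_of_rank_le hub (by omega)) ▸ le_sup_right

/-- Given two complete flags `F` and `G` in a rank `r` geometric lattice, one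
can choose coatoms `C 0, …, C (r-1)` such that for `i ≠ j`, the coatoms `C i`
and `C j` lie in different parts of the coatom partition induced by `F` and in
different parts of the coatom partition induced by `G`. -/
theorem exists_coatoms_distinct_parts {L : Type*} [Lattice L] [BoundedOrder L] [Finite L]
    {rk : L → ℕ} (hL : IsGeometricLattice L rk) {r : ℕ} (hr : rk ⊤ = r)
    (F G : Fin (r + 1) → L) (hF : IsCompleteFlag F) (hG : IsCompleteFlag G)
    (AF AG : Fin r → Set L)
    (hAF : ∀ i : Fin r, AF i = coatomsAbove (F i.castSucc) \ coatomsAbove (F i.succ))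
    (hAG : ∀ i : Fin r, AG i = coatomsAbove (G i.castSucc) \ coatomsAbove (G i.succ)) :
    ∃ C : Fin r → L, (∀ i, IsCoatom (C i)) ∧
      ∀ i j : Fin r, i ≠ j →
        (∀ k : Fin r, ¬(C i ∈ AF k ∧ C j ∈ AF k)) ∧
        (∀ k : Fin r, ¬(C i ∈ AG k ∧ C j ∈ AG k)) := by
  choose π hπn hπ using fun i : Fin r => hG.exists_sup_eq_step (hF.2.2 i)
  choose C hC hXC hFC using fun i : Fin r => hL.exists_isCoatom_not_le (hπn i)
  have memF (i : Fin r) : C i ∈ coatomsAbove (F i.castSucc) \ coatomsAbove (F i.succ) :=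
    ⟨⟨hC i, le_sup_left.trans (hXC i)⟩, fun h => hFC i h.2⟩
  have memG (i : Fin r) : C i ∈ coatomsAbove (G (π i).castSucc) \ coatomsAbove (G (π i).succ) :=
    ⟨⟨hC i, le_sup_right.trans (hXC i)⟩,
      fun h => hFC i ((hπ i).trans (sup_le (memF i).1.2 h.2))⟩
  have π_ne_of_lt {i j : Fin r} (hij : i < j) : π i ≠ π j := fun he => by
    have hle := hL.le_sup_of_covBy (hG.2.2 (π i)) (hπn i) (hπ i) (hF.2.2 i).le
    rw [he] at hle
    have hFj : F i.succ ≤ C j :=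
      (hF.monotone (Fin.succ_le_castSucc_iff.mpr hij)).trans (memF j).1.2
    exact (memG j).2 ⟨hC j, hle.trans (sup_le hFj (memG j).1.2)⟩
  refine ⟨C, hC, fun i j hij => ⟨fun k ⟨hi, hj⟩ => ?_, fun k ⟨hi, hj⟩ => ?_⟩⟩
  · rw [hAF] at hi hj
    exact hij ((hF.part_unique (memF i) hi).trans (hF.part_unique hj (memF j)))
  · rw [hAG] at hi hj
    have he : π i = π j := (hG.part_unique (memG i) hi).trans (hG.part_unique hj (memG j))
    rcases lt_or_gt_of_ne hij with h | h
    · exact π_ne_of_lt h he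
    · exact π_ne_of_lt h he.symm
end

section
/- Let (S, {T_e : e ∈ E}) be a homotopy d-arrangement and define a subset F ⊆ E to be a flat if for every e ∈ E \ F, (⋂_{f∈F} T_f) ∩ T_e ≠ ⋂_{f∈F} T_f. Then the poset of flats ordered by inclusion is a geometric lattice whose rank function is semimodular; in particular, for flats F and G, rank(F ∧ G) + rank(F ∨ G) ≤ rank(F) + rank(G). -/
open Geometry

variable {V : Type*} [NormedAddCommGroup V] [NormedSpace ℝ V] {E : Type*}

/-- The unit sphere `S^{n-1} ⊆ ℝ^n` (empty for `n = 0`). -/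
def stdSphere (n : ℕ) : Set (EuclideanSpace ℝ (Fin n)) :=
  Metric.sphere (0 : EuclideanSpace ℝ (Fin n)) 1

/-- The subspace of the realization of `S` cut out by the subcomplexes `T f`
for `f ∈ F` (all of `S` when `F = ∅`). -/
def interSpace (S : SimplicialComplex ℝ V) (T : E → SimplicialComplex ℝ V)
    (F : Set E) : Set V :=
  S.space ∩ ⋂ f ∈ F, (T f).space

/-- A homotopy `d`-arrangement: a simplicial complex `S ≃ S^d` together with
subcomplexes `T e ≃ S^{d-1}`, all of whose intersections are homotopy spheres,
carrying a free `ℤ/2` action preserving each `T e`, and such that intersecting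
a `d'`-dimensional intersection sphere `U` with some `T e ⊉ U` yields a
homotopy `(d'-1)`-sphere. -/
structure IsHomotopyArrangement (d : ℕ) (S : SimplicialComplex ℝ V)
    (T : E → SimplicialComplex ℝ V) : Prop where
  finite_faces : S.faces.Finite
  subcomplex : ∀ e : E, (T e).faces ⊆ S.faces
  sphere_S : Nonempty (ContinuousMap.HomotopyEquiv S.space (stdSphere (d + 1)))
  sphere_T : ∀ e : E, Nonempty (ContinuousMap.HomotopyEquiv (T e).space (stdSphere d))
  inter_sphere : ∀ A : Set E, ∃ n : ℕ,
    Nonempty (ContinuousMap.HomotopyEquiv (interSpace S T A) (stdSphere n))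
  free_action : ∃ σ : S.space ≃ₜ S.space,
    (∀ x, σ (σ x) = x) ∧ (∀ x, σ x ≠ x) ∧
    ∀ (e : E) (x : S.space), (x : V) ∈ (T e).space → (σ x : V) ∈ (T e).space
  inter_T : ∀ (A : Set E) (d' : ℕ),
    Nonempty (ContinuousMap.HomotopyEquiv (interSpace S T A) (stdSphere (d' + 1))) →
    ∀ t : E, ¬ interSpace S T A ⊆ (T t).space →
      Nonempty (ContinuousMap.HomotopyEquiv
        ((interSpace S T A ∩ (T t).space : Set V)) (stdSphere d'))

/-- A flat of the arrangement `(S, T)`. -/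
def IsArrFlat (S : SimplicialComplex ℝ V) (T : E → SimplicialComplex ℝ V)
    (F : Set E) : Prop :=
  ∀ e ∉ F, interSpace S T F ∩ (T e).space ≠ interSpace S T F

/-- The smallest flat containing `A` (the intersection of all flats ⊇ `A`). -/
def arrClosure (S : SimplicialComplex ℝ V) (T : E → SimplicialComplex ℝ V)
    (A : Set E) : Set E :=
  ⋂₀ {K | IsArrFlat S T K ∧ A ⊆ K}

lemma exists_weights_det_one_add (X : Type*) [NormedAddCommGroup X] [NormedSpace ℝ X]
    [FiniteDimensional ℝ X] {v : ℕ → ℝ} (hv : Function.Injective v) :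
    ∃ (N : ℕ) (w : ℕ → ℝ), ∑ i ∈ Finset.range N, w i = 1 ∧ ∀ A : X →L[ℝ] X,
      (1 + A).det = ∑ i ∈ Finset.range N, w i * (1 + v i • A).det := by
  set n := Module.finrank ℝ X
  have hinj : Set.InjOn v (Finset.range (n + 1) : Finset ℕ) := hv.injOn
  refine ⟨n + 1, fun i ↦ (Lagrange.basis (Finset.range (n + 1)) v i).eval 1, ?_, fun A ↦ ?_⟩
  · rw [← Polynomial.eval_finsetSum, Lagrange.sum_basis hinj ⟨0, by simp⟩, Polynomial.eval_one]
  · let b := Module.finBasis ℝ X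
    let M := LinearMap.toMatrix b b A.toLinearMap
    let p : Polynomial ℝ := ((Polynomial.X : Polynomial ℝ) • M.map Polynomial.C
      + (1 : Matrix (Fin n) (Fin n) ℝ).map Polynomial.C).det
    have hp (t : ℝ) : p.eval t = (1 + t • A).det := by
      have : (1 + t • A).det = (1 + t • M).det := by
        rw [ContinuousLinearMap.det, ← LinearMap.det_toMatrix b]
        congr 1
        simp only [M, ContinuousLinearMap.toLinearMap_add, ContinuousLinearMap.toLinearMap_smul,
          map_add, map_smul]
        congr 1
        exact LinearMap.toMatrix_one b
      rw [this, ← Polynomial.coe_evalRingHom, RingHom.map_det]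
      congr 1
      ext i j
      simp only [RingHom.mapMatrix_apply, Matrix.map_apply, Matrix.add_apply, Matrix.smul_apply,
        Polynomial.coe_evalRingHom, Polynomial.eval_add, Polynomial.eval_C, smul_eq_mul,
        Polynomial.eval_mul, Polynomial.eval_X]
      ring
    have hdeg : p.degree < (Finset.range (n + 1)).card := by
      refine Polynomial.degree_le_natDegree.trans_lt ?_
      rw [Finset.card_range]
      exact_mod_cast Nat.lt_succ_of_le <|
        (Polynomial.natDegree_det_X_add_C_le M (1 : Matrix (Fin n) (Fin n) ℝ)).trans_eq
          (Fintype.card_fin n)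
    have h1 := congrArg (Polynomial.eval 1) (Lagrange.eq_interpolate hinj hdeg)
    rw [Lagrange.interpolate_apply, Polynomial.eval_finsetSum, hp] at h1
    simpa [hp, mul_comm] using h1

lemma bijective_id_add_of_contracting {X : Type*} [NormedAddCommGroup X] [CompleteSpace X]
    {g : X → X} {K : NNReal} (hK : K < 1) (hg : LipschitzWith K g) :
    Function.Bijective fun x ↦ x + g x := by
  constructor
  · intro x y hxy
    have h1 : x - y = g y - g x := by
      simp only at hxy
      rw [sub_eq_sub_iff_add_eq_add, hxy, add_comm]
    have h2 := hg.dist_le_mul y x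
    rw [dist_eq_norm, ← h1, dist_comm, dist_eq_norm] at h2
    have hK' : (K : ℝ) < 1 := by exact_mod_cast hK
    rw [← sub_eq_zero, ← norm_eq_zero]
    nlinarith [norm_nonneg (x - y)]
  · intro y
    have hc : ContractingWith K fun x ↦ y - g x := ⟨hK, by
      refine LipschitzWith.of_dist_le_mul fun a b ↦ ?_
      rw [dist_sub_left]
      exact hg.dist_le_mul a b⟩
    have h := hc.fixedPoint_isFixedPt
    refine ⟨hc.fixedPoint, ?_⟩
    have : y - g hc.fixedPoint = hc.fixedPoint := h
    exact (sub_eq_iff_eq_add.1 this).symm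

section Retraction

variable {X : Type*} [NormedAddCommGroup X] [InnerProductSpace ℝ X]

open MeasureTheory

lemma image_closedBall_id_add_smul_sub {r : X → X} (hr : ∀ x, ‖r x‖ = 1)
    (hr' : ∀ x, 1 ≤ ‖x‖ → r x = ‖x‖⁻¹ • x) {t : ℝ} (ht0 : 0 ≤ t) (ht1 : t < 1)
    (hsurj : Function.Surjective fun x ↦ x + t • (r x - x)) :
    (fun x ↦ x + t • (r x - x)) '' Metric.closedBall 0 1 = Metric.closedBall 0 1 := by
  ext y
  simp only [Set.mem_image, mem_closedBall_zero_iff]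
  constructor
  · rintro ⟨x, hx, rfl⟩
    calc ‖x + t • (r x - x)‖ = ‖(1 - t) • x + t • r x‖ := by congr 1; module
      _ ≤ ‖(1 - t) • x‖ + ‖t • r x‖ := norm_add_le _ _
      _ = (1 - t) * ‖x‖ + t := by
        rw [norm_smul, norm_smul, hr, Real.norm_of_nonneg ht0,
          Real.norm_of_nonneg (by linarith), mul_one]
      _ ≤ 1 := by nlinarith
  · intro hy
    obtain ⟨x, rfl⟩ := hsurj y
    refine ⟨x, ?_, rfl⟩
    by_contra! hx
    have h1 : x + t • (r x - x) = (1 - t + t * ‖x‖⁻¹) • x := by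
      rw [hr' x hx.le]; module
    have h0 : 0 < ‖x‖ := by linarith
    simp only [h1, norm_smul] at hy
    rw [Real.norm_of_nonneg (by have := inv_pos.2 h0; nlinarith), add_mul, mul_assoc,
      inv_mul_cancel₀ h0.ne'] at hy
    nlinarith

lemma det_eq_zero_of_norm_eq_one [FiniteDimensional ℝ X] [Nontrivial X] {r : X → X} (hr : ∀ x, ‖r x‖ = 1) {x : X}
    {A : X →L[ℝ] X} (hA : HasFDerivAt r A x) : A.det = 0 := by
  by_contra h
  have hs : Function.Surjective A :=
    (LinearMap.equivOfDetNeZero A.toLinearMap h).surjective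
  obtain ⟨u, hu⟩ := hs (r x)
  have h1 := (hA.inner ℝ hA)
  have h2 : (fun y ↦ inner ℝ (r y) (r y)) = fun _ ↦ (1 : ℝ) := by
    ext y; rw [real_inner_self_eq_norm_sq, hr]; norm_num
  rw [h2] at h1
  have h3 := congrArg (fun L ↦ L u) (h1.unique (hasFDerivAt_const (1 : ℝ) x))
  simp [hu, hr] at h3

theorem not_exists_contDiff_retraction [FiniteDimensional ℝ X] [Nontrivial X] {r : X → X}
    (hr1 : ContDiff ℝ 1 r) {K : NNReal} (hK : LipschitzWith K r) (hr : ∀ x, ‖r x‖ = 1)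
    (hr' : ∀ x, 1 ≤ ‖x‖ → r x = ‖x‖⁻¹ • x) : False := by
  borelize X
  let μ : Measure X := Measure.addHaar
  let B : Set X := Metric.closedBall 0 1
  let g : X → X := fun x ↦ r x - x
  have hg : LipschitzWith (K + 1) g := hK.sub LipschitzWith.id
  have hg1 : ContDiff ℝ 1 g := hr1.sub contDiff_id
  have hgd (x : X) : HasFDerivAt g (fderiv ℝ g x) x :=
    (hg1.differentiable one_ne_zero x).hasFDerivAt
  have hcont (t : ℝ) : Continuous fun x ↦ (1 + t • fderiv ℝ g x).det :=
    ContinuousLinearMap.continuous_det.comp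
      (continuous_const.add ((hg1.continuous_fderiv one_ne_zero).const_smul t))
  obtain ⟨ε, hε, hdet⟩ : ∃ ε > 0, ∀ A : X →L[ℝ] X, ‖A‖ < ε → 0 < (1 + A).det := by
    have h1 : ContinuousAt (fun A : X →L[ℝ] X ↦ (1 + A).det) 0 :=
      (ContinuousLinearMap.continuous_det.comp (continuous_const.add continuous_id)).continuousAt
    have h2 : (0 : ℝ) < (1 + (0 : X →L[ℝ] X)).det := by
      rw [add_zero]
      exact one_pos.trans_eq LinearMap.det_id.symm
    obtain ⟨ε, hε, h⟩ := Metric.eventually_nhds_iff.1 (h1.eventually (lt_mem_nhds h2))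
    exact ⟨ε, hε, fun A hA ↦ h (by simpa using hA)⟩
  have key (t : ℝ) (ht0 : 0 < t) (ht1 : t * (K + 1) < 1) (ht2 : t * (K + 1) < ε) :
      ∫ x in B, (1 + t • fderiv ℝ g x).det ∂μ = μ.real B := by
    lift t to NNReal using ht0.le
    have hbij := bijective_id_add_of_contracting (g := fun x ↦ (t : ℝ) • g x) (K := t * (K + 1))
      (by exact_mod_cast ht1) (by
        refine LipschitzWith.of_dist_le_mul fun a b ↦ ?_
        rw [dist_smul₀, Real.norm_of_nonneg ht0.le]
        have := mul_le_mul_of_nonneg_left (hg.dist_le_mul a b) ht0.le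
        simpa [mul_assoc] using this)
    have himg := image_closedBall_id_add_smul_sub hr hr' ht0.le
      (by have := K.coe_nonneg; nlinarith) hbij.2
    have h := integral_image_eq_integral_abs_det_fderiv_smul μ (s := B)
      (f := fun x ↦ x + (t : ℝ) • g x) (f' := fun x ↦ 1 + (t : ℝ) • fderiv ℝ g x)
      Metric.isClosed_closedBall.measurableSet
      (fun x _ ↦ ((hasFDerivAt_id x).add ((hgd x).const_smul t)).hasFDerivWithinAt)
      hbij.1.injOn (fun _ ↦ (1 : ℝ))
    rw [himg] at h
    simp only [smul_eq_mul, mul_one, integral_const, measureReal_restrict_apply_univ] at h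
    rw [h]
    congr 1
    ext x
    refine (abs_of_pos (hdet _ ?_)).symm
    rw [norm_smul, Real.norm_of_nonneg ht0.le]
    refine lt_of_le_of_lt (mul_le_mul_of_nonneg_left ?_ ht0.le) ht2
    simpa using norm_fderiv_le_of_lipschitz ℝ hg (x₀ := x)
  let δ : ℝ := min 1 ε / (2 * (K + 1))
  have hK0 : (0 : ℝ) < K + 1 := by positivity
  have hm : 0 < min 1 ε := lt_min one_pos hε
  have hδ : 0 < δ := by positivity
  have hδ' : δ * (K + 1) < min 1 ε := by
    have : δ * (K + 1) = min 1 ε / 2 := by simp only [δ]; field_simp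
    linarith
  let v : ℕ → ℝ := fun i ↦ δ / (i + 1)
  have hv : Function.Injective v := by
    intro i j h
    simp only [v] at h
    field_simp at h
    exact_mod_cast (by linarith : (i : ℝ) = j)
  have hvδ (i : ℕ) : v i ≤ δ := div_le_self hδ.le (by simp)
  have hv0 (i : ℕ) : 0 < v i := by positivity
  obtain ⟨N, w, hw, hA⟩ := exists_weights_det_one_add X hv
  have hvol (i : ℕ) : ∫ x in B, (1 + v i • fderiv ℝ g x).det ∂μ = μ.real B := by
    have h : v i * (K + 1) < min 1 ε :=
      (mul_le_mul_of_nonneg_right (hvδ i) hK0.le).trans_lt hδ'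
    exact key _ (hv0 i) (h.trans_le (min_le_left _ _)) (h.trans_le (min_le_right _ _))
  have h1 : ∫ x in B, (1 + fderiv ℝ g x).det ∂μ = μ.real B := by
    rw [funext fun x ↦ hA (fderiv ℝ g x), integral_finsetSum]
    · simp_rw [integral_const_mul, hvol, ← Finset.sum_mul, hw, one_mul]
    · intro i _
      exact ((hcont (v i)).continuousOn.integrableOn_compact
        (isCompact_closedBall 0 1)).const_mul _
  have h2 (x : X) : (1 + fderiv ℝ g x).det = 0 := by
    refine det_eq_zero_of_norm_eq_one hr (x := x) ?_
    have := (hasFDerivAt_id x).add (hgd x)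
    refine this.congr_of_eventuallyEq (.of_forall fun y ↦ ?_)
    simp [g]
  simp only [h2, integral_zero] at h1
  have h3 : 0 < μ B := Metric.measure_closedBall_pos μ 0 one_pos
  exact (ENNReal.toReal_pos h3.ne' (isCompact_closedBall 0 1).measure_lt_top.ne).ne h1

end Retraction

section Sphere

variable {X : Type*} [NormedAddCommGroup X] [InnerProductSpace ℝ X]

/-- The radial projection of a nonvanishing continuous map onto the unit sphere. -/
noncomputable def radialProjection {Y : Type*} [TopologicalSpace Y] (f : C(Y, X))
    (hf : ∀ y, f y ≠ 0) : C(Y, Metric.sphere (0 : X) 1) where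
  toFun y := ⟨‖f y‖⁻¹ • f y, by simp [norm_smul, hf y]⟩
  continuous_toFun := by
    refine Continuous.subtype_mk ?_ _
    exact (f.continuous.norm.inv₀ fun y ↦ norm_ne_zero_iff.2 (hf y)).smul f.continuous

open unitInterval in
lemma radialProjection_homotopic {Y : Type*} [TopologicalSpace Y] {f g : C(Y, X)}
    (hf : ∀ y, f y ≠ 0) (hg : ∀ y, g y ≠ 0)
    (hfg : ∀ y, ∀ s : ℝ, 0 < s → s < 1 → (1 - s) • f y + s • g y ≠ 0) :
    (radialProjection f hf).Homotopic (radialProjection g hg) := by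
  let F : C(I × Y, X) := ⟨fun p ↦ (1 - (p.1 : ℝ)) • f p.2 + (p.1 : ℝ) • g p.2, by fun_prop⟩
  have hF : ∀ p, F p ≠ 0 := by
    rintro ⟨s, y⟩
    change (1 - (s : ℝ)) • f y + (s : ℝ) • g y ≠ 0
    rcases s.2.1.eq_or_lt with h0 | h0
    · simpa [← h0] using hf y
    rcases s.2.2.eq_or_lt with h1 | h1
    · simpa [h1] using hg y
    exact hfg y s h0 h1
  exact ⟨{ toContinuousMap := radialProjection F hF
           map_zero_left := fun y ↦ by simp [radialProjection, F]
           map_one_left := fun y ↦ by simp [radialProjection, F] }⟩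

theorem not_nullhomotopic_id_sphere [FiniteDimensional ℝ X] [Nontrivial X] :
    ¬ (ContinuousMap.id (Metric.sphere (0 : X) 1)).Nullhomotopic := by
  rintro ⟨c, ⟨H⟩⟩
  classical
  let u : X → Metric.sphere (0 : X) 1 := fun x ↦
    if h : x = 0 then c else ⟨‖x‖⁻¹ • x, by simp [norm_smul, h]⟩
  have hu (x : X) (hx : x ≠ 0) : (u x : X) = ‖x‖⁻¹ • x := by simp [u, hx]
  have hu_cont (x : X) (hx : x ≠ 0) : ContinuousAt u x := by
    rw [Topology.IsInducing.subtypeVal.continuousAt_iff]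
    have h1 : ContinuousAt (fun x : X ↦ ‖x‖⁻¹ • x) x :=
      (continuousAt_id.norm.inv₀ (norm_ne_zero_iff.2 hx)).smul continuousAt_id
    refine h1.congr ?_
    filter_upwards [isOpen_ne.mem_nhds hx] with y hy using (hu y hy).symm
  let k : X → Metric.sphere (0 : X) 1 := fun x ↦ H.extend (2 - 4 * ‖x‖) (u x)
  have hk_cont : Continuous k := by
    rw [continuous_iff_continuousAt]
    intro x
    by_cases hx : x = 0
    · subst hx
      refine (continuousAt_const (y := c)).congr ?_
      filter_upwards [Metric.ball_mem_nhds (0 : X) (show (0 : ℝ) < 1 / 4 by norm_num)] with y hy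
      rw [mem_ball_zero_iff] at hy
      exact (H.extend_apply_of_one_le (by linarith) (u y)).symm
    · exact ContinuousAt.eval (by fun_prop) (hu_cont x hx)
  have hk (x : X) (hx : 1 / 2 ≤ ‖x‖) : (k x : X) = ‖x‖⁻¹ • x := by
    rw [← hu x (norm_pos_iff.1 (by linarith))]
    exact congrArg _ (H.extend_apply_of_le_zero (by linarith) (u x))
  let h : X → X := fun x ↦ max ‖x‖ (1 / 2) • (k x : X)
  have hh_cont : Continuous h := by fun_prop
  have hh (x : X) (hx : 1 / 2 ≤ ‖x‖) : h x = x := by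
    simp only [h]
    rw [hk x hx, max_eq_left hx, smul_smul, mul_inv_cancel₀ (by linarith), one_smul]
  have hh_norm (x : X) : 1 / 2 ≤ ‖h x‖ := by
    simp only [h, norm_smul, norm_eq_of_mem_sphere, mul_one]
    exact (le_max_right _ _).trans (le_abs_self _)
  let U : Set X := {x | 1 / 2 < ‖x‖}
  have hU : IsOpen U := isOpen_lt continuous_const continuous_norm
  obtain ⟨F, hF, hFh, hFeq, -⟩ := hh_cont.exists_contDiff_approx_and_eqOn 1
    (continuous_const (y := (1 / 2 : ℝ))) (fun _ ↦ by norm_num)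
    (S := {x | 1 ≤ ‖x‖}) (U := U) (isClosed_le continuous_const continuous_norm)
    (hU.mem_nhdsSet.2 fun x (hx : 1 ≤ ‖x‖) ↦ show 1 / 2 < ‖x‖ by linarith)
    (contDiffOn_id.congr fun x (hx : 1 / 2 < ‖x‖) ↦ hh x hx.le)
  have hFid (x : X) (hx : 1 ≤ ‖x‖) : F x = x := (hFeq hx).trans (hh x (by linarith))
  have hF0 (x : X) : F x ≠ 0 := by
    intro h0
    have := hFh x
    rw [h0, dist_zero_left] at this
    linarith [hh_norm x]
  obtain ⟨m, hm, hFm⟩ : ∃ m > 0, ∀ x, m ≤ ‖F x‖ := by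
    obtain ⟨x₀, -, hx₀⟩ := (isCompact_closedBall (0 : X) 1).exists_isMinOn
      ⟨0, by simp⟩ hF.continuous.norm.continuousOn
    refine ⟨min 1 ‖F x₀‖, lt_min one_pos (norm_pos_iff.2 (hF0 _)), fun x ↦ ?_⟩
    rcases le_total 1 ‖x‖ with hx | hx
    · rw [hFid x hx]
      exact (min_le_left _ _).trans hx
    · exact (min_le_right _ _).trans (hx₀ (mem_closedBall_zero_iff.2 hx))
  obtain ⟨C, hC⟩ : ∃ C, LipschitzWith C F := by
    have hsupp : HasCompactSupport fun x ↦ F x - x :=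
      HasCompactSupport.intro (isCompact_closedBall (0 : X) 1) fun x hx ↦ by
        rw [hFid x (by simpa using (not_le.1 (mt mem_closedBall_zero_iff.2 hx)).le), sub_self]
    obtain ⟨C, hC⟩ := ContDiff.lipschitzWith_of_hasCompactSupport hsupp
      (hF.sub contDiff_id) one_ne_zero
    exact ⟨C + 1, by simpa using hC.add LipschitzWith.id⟩
  refine not_exists_contDiff_retraction (r := fun x ↦ ‖F x‖⁻¹ • F x)
    (K := ⟨2 / m, by positivity⟩ * C) ?_ ?_ ?_ ?_
  · exact ((hF.norm ℝ hF0).inv fun x ↦ norm_ne_zero_iff.2 (hF0 x)).smul hF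
  · refine LipschitzWith.of_dist_le_mul fun x y ↦ ?_
    have hx := (hm.trans_le (hFm x))
    have hy := (hm.trans_le (hFm y))
    have h1 : ‖F x‖⁻¹ • F x - ‖F y‖⁻¹ • F y
        = ‖F x‖⁻¹ • ((F x - F y) + (‖F y‖ - ‖F x‖) • (‖F y‖⁻¹ • F y)) := by
      have h0 : ‖F x‖⁻¹ * ((‖F y‖ - ‖F x‖) * ‖F y‖⁻¹) = ‖F x‖⁻¹ - ‖F y‖⁻¹ := by field_simp
      rw [smul_add, smul_smul, smul_smul, mul_assoc, h0]
      module
    have h2 : ‖(‖F y‖ - ‖F x‖) • (‖F y‖⁻¹ • F y)‖ ≤ ‖F x - F y‖ := by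
      rw [norm_smul, norm_smul, norm_inv, norm_norm, inv_mul_cancel₀ hy.ne', mul_one,
        Real.norm_eq_abs, norm_sub_rev]
      exact abs_norm_sub_norm_le _ _
    rw [dist_eq_norm, h1, norm_smul, norm_inv, norm_norm]
    have h3 := hC.dist_le_mul x y
    rw [dist_eq_norm] at h3
    calc ‖F x‖⁻¹ * ‖(F x - F y) + (‖F y‖ - ‖F x‖) • (‖F y‖⁻¹ • F y)‖
        ≤ m⁻¹ * (C * dist x y + C * dist x y) := by
          gcongr
          · exact hFm x
          · exact (norm_add_le _ _).trans (add_le_add h3 (h2.trans h3))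
      _ = (2 / m) * C * dist x y := by ring
  · intro x
    simp [norm_smul, hF0 x]
  · intro x hx
    simp only [hFid x hx]

variable {Y : Type*} [NormedAddCommGroup Y] [InnerProductSpace ℝ Y]

theorem nullhomotopic_of_finrank_lt [FiniteDimensional ℝ X] [FiniteDimensional ℝ Y]
    (hXY : Module.finrank ℝ X < Module.finrank ℝ Y)
    (f : C(Metric.sphere (0 : X) 1, Metric.sphere (0 : Y) 1)) : f.Nullhomotopic := by
  have : Nontrivial Y := Module.finrank_pos_iff.1 (by omega : 0 < Module.finrank ℝ Y)
  let f' : C(Metric.sphere (0 : X) 1, Y) := ⟨fun x ↦ f x, by fun_prop⟩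
  obtain ⟨F, hF⟩ := ContinuousMap.exists_restrict_eq Metric.isClosed_sphere f'
  have hFf (x : Metric.sphere (0 : X) 1) : F x = f x := congrArg (fun φ ↦ φ x) hF
  obtain ⟨G, hG, hGF, -⟩ := F.continuous.exists_contDiff_approx 1
    (continuous_const (y := (1 : ℝ))) fun _ ↦ one_pos
  let P : X → Y := fun x ↦ ‖x‖ • G (‖x‖⁻¹ • x)
  have hP : dimH (P '' {x | x ≠ 0}) < Module.finrank ℝ Y := by
    refine ((dimH_image_le_of_locally_lipschitzOn fun x (hx : x ≠ 0) ↦ ?_).trans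
      ((dimH_mono (Set.subset_univ _)).trans_eq (Real.dimH_univ_eq_finrank X))).trans_lt
      (by exact_mod_cast hXY)
    have hn : ContDiffAt ℝ 1 (fun x : X ↦ ‖x‖) x := contDiffAt_norm ℝ hx
    have h1 : ContDiffAt ℝ 1 P x := hn.smul
      (hG.contDiffAt.comp x ((hn.inv (norm_ne_zero_iff.2 hx)).smul contDiffAt_id))
    obtain ⟨K, t, ht, hK⟩ := h1.exists_lipschitzOnWith
    exact ⟨K, t, mem_nhdsWithin_of_mem_nhds ht, hK⟩
  obtain ⟨p, hp0, hp⟩ := (dense_compl_of_dimH_lt_finrank hP).inter_open_nonempty {0}ᶜ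
    isOpen_compl_singleton (by
      obtain ⟨y, hy⟩ := exists_ne (0 : Y)
      exact ⟨y, hy⟩)
  replace hp0 : p ≠ 0 := hp0
  have hray (x : Metric.sphere (0 : X) 1) (a : ℝ) (ha : 0 < a) : a • G x ≠ p := by
    intro h
    refine hp ⟨a • (x : X), smul_ne_zero ha.ne' (ne_zero_of_mem_unit_sphere x), ?_⟩
    simp only [P]
    rw [norm_smul, norm_eq_of_mem_sphere, mul_one, Real.norm_of_nonneg ha.le, smul_smul,
      inv_mul_cancel₀ ha.ne', one_smul, h]
  let G' : C(Metric.sphere (0 : X) 1, Y) := ⟨fun x ↦ G x, by have := hG.continuous; fun_prop⟩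
  have hf' (x) : f' x ≠ 0 := ne_zero_of_mem_unit_sphere (f x)
  have hfG (x : Metric.sphere (0 : X) 1) : ‖(f x : Y) - G x‖ < 1 := by
    rw [← dist_eq_norm, dist_comm, ← hFf]
    exact hGF x
  have hG' (x) : G' x ≠ 0 := by
    intro h
    have h1 := hfG x
    rw [show G x = 0 from h, sub_zero, norm_eq_of_mem_sphere] at h1
    exact lt_irrefl _ h1
  have h1 : radialProjection f' hf' = f := by
    ext x
    simp [radialProjection, f']
  let q : C(Metric.sphere (0 : X) 1, Y) := ContinuousMap.const _ (-p)
  have hq (x) : q x ≠ 0 := neg_ne_zero.2 hp0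
  have h2 : (radialProjection f' hf').Homotopic (radialProjection G' hG') := by
    refine radialProjection_homotopic hf' hG' fun x s hs0 hs1 h ↦ ?_
    have h3 : (f x : Y) = s • ((f x : Y) - G x) := by
      refine sub_eq_zero.1 (Eq.trans ?_ h)
      change _ = (1 - s) • (f x : Y) + s • G x
      module
    have h4 := congrArg norm h3
    rw [norm_eq_of_mem_sphere, norm_smul, Real.norm_of_nonneg hs0.le] at h4
    nlinarith [hfG x]
  have h3 : (radialProjection G' hG').Homotopic (radialProjection q hq) := by
    refine radialProjection_homotopic hG' hq fun x s hs0 hs1 h ↦ ?_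
    refine hray x (s⁻¹ * (1 - s)) (mul_pos (inv_pos.2 hs0) (by linarith)) ?_
    have h4 : (1 - s) • G x = s • p := by
      rw [← sub_eq_zero, ← h]
      change _ = (1 - s) • G x + s • (-p)
      module
    rw [mul_smul, h4, smul_smul, inv_mul_cancel₀ hs0.ne', one_smul]
  refine ⟨⟨‖-p‖⁻¹ • -p, by simp [norm_smul, hp0]⟩, ?_⟩
  rw [h1] at h2
  exact h2.trans h3

theorem not_nonempty_homotopyEquiv_sphere_of_finrank_lt [FiniteDimensional ℝ X]
    [FiniteDimensional ℝ Y] (hXY : Module.finrank ℝ X < Module.finrank ℝ Y) :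
    ¬ Nonempty (ContinuousMap.HomotopyEquiv (Metric.sphere (0 : X) 1)
      (Metric.sphere (0 : Y) 1)) := by
  rintro ⟨e⟩
  rcases subsingleton_or_nontrivial X with hX | hX
  · have : Nontrivial Y := Module.finrank_pos_iff.1 (by omega : 0 < Module.finrank ℝ Y)
    obtain ⟨y, hy⟩ := NormedSpace.sphere_nonempty (x := (0 : Y)) (r := 1) |>.2 zero_le_one
    exact ne_zero_of_mem_unit_sphere (e.invFun ⟨y, hy⟩) (Subsingleton.elim _ _)
  · obtain ⟨c, hc⟩ := (nullhomotopic_of_finrank_lt hXY e.toFun).comp_right e.invFun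
    exact not_nullhomotopic_id_sphere ⟨c, e.left_inv.symm.trans hc⟩

end Sphere

theorem stdSphere_homotopyEquiv_unique {Z : Type*} [TopologicalSpace Z] {m n : ℕ}
    (hm : Nonempty (ContinuousMap.HomotopyEquiv Z (stdSphere m)))
    (hn : Nonempty (ContinuousMap.HomotopyEquiv Z (stdSphere n))) : m = n := by
  obtain ⟨e⟩ := hm
  obtain ⟨e'⟩ := hn
  by_contra h
  rcases lt_or_gt_of_ne h with h | h
  · exact not_nonempty_homotopyEquiv_sphere_of_finrank_lt (X := EuclideanSpace ℝ (Fin m))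
      (Y := EuclideanSpace ℝ (Fin n)) (by simpa using h) ⟨e.symm.trans e'⟩
  · exact not_nonempty_homotopyEquiv_sphere_of_finrank_lt (X := EuclideanSpace ℝ (Fin n))
      (Y := EuclideanSpace ℝ (Fin m)) (by simpa using h) ⟨e'.symm.trans e⟩

section Closure

variable {S : SimplicialComplex ℝ V} {T : E → SimplicialComplex ℝ V} {A B F : Set E} {e : E}

lemma interSpace_anti (h : A ⊆ B) : interSpace S T B ⊆ interSpace S T A :=
  Set.inter_subset_inter_right _ (Set.biInter_subset_biInter_left h)

lemma interSpace_subset_space (h : e ∈ A) : interSpace S T A ⊆ (T e).space :=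
  Set.inter_subset_right.trans (Set.biInter_subset_of_mem h)

lemma interSpace_insert : interSpace S T (insert e A) = interSpace S T A ∩ (T e).space := by
  rw [interSpace, interSpace, Set.biInter_insert, Set.inter_comm (T e).space, Set.inter_assoc]

lemma isArrFlat_iff :
    IsArrFlat S T F ↔ ∀ e, interSpace S T F ⊆ (T e).space → e ∈ F := by
  refine forall_congr' fun e ↦ ?_
  rw [Ne, Set.inter_eq_left, not_imp_not]

lemma interSpace_setOf_subset :
    interSpace S T {e | interSpace S T A ⊆ (T e).space} = interSpace S T A :=
  (interSpace_anti fun _ he ↦ interSpace_subset_space he).antisymm fun _ hx ↦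
    ⟨hx.1, Set.mem_iInter₂.2 fun _ he ↦ he hx⟩

lemma arrClosure_eq : arrClosure S T A = {e | interSpace S T A ⊆ (T e).space} := by
  refine Set.Subset.antisymm (Set.sInter_subset_of_mem ⟨?_, fun _ ↦ interSpace_subset_space⟩) ?_
  · rw [isArrFlat_iff]
    intro e he
    rwa [interSpace_setOf_subset] at he
  · rintro e he K ⟨hK, hAK⟩
    exact isArrFlat_iff.1 hK e ((interSpace_anti hAK).trans he)

lemma mem_arrClosure : e ∈ arrClosure S T A ↔ interSpace S T A ⊆ (T e).space := by
  rw [arrClosure_eq, Set.mem_ofPred_eq]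

lemma interSpace_arrClosure : interSpace S T (arrClosure S T A) = interSpace S T A := by
  rw [arrClosure_eq, interSpace_setOf_subset]

lemma isArrFlat_arrClosure : IsArrFlat S T (arrClosure S T A) :=
  isArrFlat_iff.2 fun e he ↦ by rwa [interSpace_arrClosure, ← mem_arrClosure] at he

lemma subset_arrClosure : A ⊆ arrClosure S T A := fun _ he ↦
  mem_arrClosure.2 (interSpace_subset_space he)

lemma IsArrFlat.arrClosure_subset (hF : IsArrFlat S T F) (h : A ⊆ F) : arrClosure S T A ⊆ F :=
  Set.sInter_subset_of_mem ⟨hF, h⟩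

lemma IsArrFlat.inter {G : Set E} (hF : IsArrFlat S T F) (hG : IsArrFlat S T G) :
    IsArrFlat S T (F ∩ G) := by
  rw [isArrFlat_iff] at hF hG ⊢
  exact fun e he ↦ ⟨hF e ((interSpace_anti Set.inter_subset_left).trans he),
    hG e ((interSpace_anti Set.inter_subset_right).trans he)⟩

end Closure

section Rank

variable {d : ℕ} {S : SimplicialComplex ℝ V} {T : E → SimplicialComplex ℝ V}

/-- The corank of `A`: the index `n` for which `interSpace S T A` is homotopy equivalent to
`stdSphere n`. -/
noncomputable def IsHomotopyArrangement.corank (h : IsHomotopyArrangement d S T) (A : Set E) : ℕ :=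
  (h.inter_sphere A).choose

variable (h : IsHomotopyArrangement d S T) {A B : Set E} {e : E}

lemma IsHomotopyArrangement.nonempty_homotopyEquiv_corank : Nonempty
    (ContinuousMap.HomotopyEquiv (interSpace S T A) (stdSphere (h.corank A))) :=
  (h.inter_sphere A).choose_spec

lemma IsHomotopyArrangement.corank_congr (hAB : interSpace S T A = interSpace S T B) :
    h.corank A = h.corank B := by
  refine stdSphere_homotopyEquiv_unique h.nonempty_homotopyEquiv_corank ?_
  rw [hAB]
  exact h.nonempty_homotopyEquiv_corank

lemma IsHomotopyArrangement.corank_empty : h.corank ∅ = d + 1 := by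
  refine stdSphere_homotopyEquiv_unique h.nonempty_homotopyEquiv_corank ?_
  have : interSpace S T ∅ = S.space := by simp [interSpace]
  rw [this]
  exact h.sphere_S

lemma IsHomotopyArrangement.corank_insert_of_mem (he : e ∈ arrClosure S T A) :
    h.corank (insert e A) = h.corank A :=
  h.corank_congr (by rw [interSpace_insert, Set.inter_eq_left.2 (mem_arrClosure.1 he)])

lemma IsHomotopyArrangement.corank_insert_of_notMem (he : e ∉ arrClosure S T A) :
    h.corank (insert e A) + 1 = h.corank A := by
  have hA := h.nonempty_homotopyEquiv_corank (A := A)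
  rw [mem_arrClosure] at he
  cases hn : h.corank A with
  | zero =>
    rw [hn] at hA
    obtain ⟨f⟩ := hA
    obtain ⟨x, hx, -⟩ := Set.not_subset.1 he
    let y : Metric.sphere (0 : EuclideanSpace ℝ (Fin 0)) 1 := f ⟨x, hx⟩
    exact absurd (Subsingleton.elim _ _) (ne_zero_of_mem_unit_sphere y)
  | succ n =>
    rw [hn] at hA
    have h1 := h.inter_T A n hA e he
    rw [← interSpace_insert] at h1
    rw [stdSphere_homotopyEquiv_unique h.nonempty_homotopyEquiv_corank h1]

lemma IsHomotopyArrangement.corank_le [Finite E] : h.corank A ≤ d + 1 := by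
  induction A, A.toFinite using Set.Finite.induction_on with
  | empty => exact h.corank_empty.le
  | @insert e A _ _ ih =>
    by_cases he : e ∈ arrClosure S T A
    · rwa [h.corank_insert_of_mem he]
    · have := h.corank_insert_of_notMem he
      omega

lemma IsHomotopyArrangement.corank_supermodular [Finite E] (C : Set E) (hAB : A ⊆ B) :
    h.corank A + h.corank (B ∪ C) ≥ h.corank (A ∪ C) + h.corank B := by
  induction C, C.toFinite using Set.Finite.induction_on with
  | empty => simp
  | @insert e C _ _ ih =>
    rw [Set.union_insert, Set.union_insert]
    by_cases hA : e ∈ arrClosure S T (A ∪ C)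
    · have hB : e ∈ arrClosure S T (B ∪ C) := mem_arrClosure.2 <|
        (interSpace_anti (Set.union_subset_union_left C hAB)).trans (mem_arrClosure.1 hA)
      rwa [h.corank_insert_of_mem hA, h.corank_insert_of_mem hB]
    · have h1 := h.corank_insert_of_notMem hA
      by_cases hB : e ∈ arrClosure S T (B ∪ C)
      · have := h.corank_insert_of_mem hB
        omega
      · have := h.corank_insert_of_notMem hB
        omega

end Rank

/-- The flats of a homotopy `d`-arrangement, ordered by inclusion, form a
geometric lattice: meets are intersections, joins are closures of unions, the
rank function (given by `rank F = d + 1 - k - 1` when `⋂_{f ∈ F} T f ≃ S^k`)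
is the rank function of a graded atomistic lattice, and it is semimodular:
`rank (F ⊓ G) + rank (F ⊔ G) ≤ rank F + rank G`. -/
theorem arrangement_flats_geometric_lattice [Finite E]
    (d : ℕ) (S : SimplicialComplex ℝ V) (T : E → SimplicialComplex ℝ V)
    (hArr : IsHomotopyArrangement d S T) :
    ∃ rk : Set E → ℕ,
      -- the rank of a flat is determined by the dimension of its homotopy sphere
      (∀ F : Set E, IsArrFlat S T F → rk F ≤ d + 1 ∧
        Nonempty (ContinuousMap.HomotopyEquiv (interSpace S T F)
          (stdSphere (d + 1 - rk F)))) ∧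
      -- meets: the intersection of two flats is a flat
      (∀ F G : Set E, IsArrFlat S T F → IsArrFlat S T G → IsArrFlat S T (F ∩ G)) ∧
      -- joins: the closure of the union of two flats is a flat
      (∀ F G : Set E, IsArrFlat S T F → IsArrFlat S T G →
        IsArrFlat S T (arrClosure S T (F ∪ G))) ∧
      -- the lattice of flats is graded by `rk`, starting at the bottom flat
      rk (arrClosure S T ∅) = 0 ∧
      (∀ F G : Set E, IsArrFlat S T F → IsArrFlat S T G → F ⊂ G →
        (∀ K : Set E, IsArrFlat S T K → F ⊆ K → K ⊆ G → K = F ∨ K = G) →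
        rk G = rk F + 1) ∧
      -- atomistic: every flat is the join of the rank-one flats below it
      (∀ F : Set E, IsArrFlat S T F →
        F = arrClosure S T (⋃₀ {a : Set E | IsArrFlat S T a ∧ rk a = 1 ∧ a ⊆ F})) ∧
      -- semimodularity of the rank function
      (∀ F G : Set E, IsArrFlat S T F → IsArrFlat S T G →
        rk (F ∩ G) + rk (arrClosure S T (F ∪ G)) ≤ rk F + rk G) := by
  have hle (A : Set E) : hArr.corank A ≤ d + 1 := hArr.corank_le
  refine ⟨fun A ↦ d + 1 - hArr.corank A, fun F _ ↦ ⟨Nat.sub_le _ _, ?_⟩,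
    fun F G hF hG ↦ hF.inter hG, fun _ _ _ _ ↦ isArrFlat_arrClosure, ?_, ?_, ?_, ?_⟩
  · rw [Nat.sub_sub_self (hle F)]
    exact hArr.nonempty_homotopyEquiv_corank
  · simp [hArr.corank_congr interSpace_arrClosure, hArr.corank_empty]
  · intro F G hF hG hFG hcov
    obtain ⟨e, heG, heF⟩ := Set.exists_of_ssubset hFG
    have hsub : insert e F ⊆ arrClosure S T (insert e F) := subset_arrClosure
    have hGe : arrClosure S T (insert e F) = G :=
      (hcov _ isArrFlat_arrClosure ((Set.subset_insert _ _).trans hsub)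
        (hG.arrClosure_subset (Set.insert_subset heG hFG.subset))).resolve_left
        fun h ↦ heF (h ▸ hsub (Set.mem_insert _ _))
    have h1 := hArr.corank_congr (interSpace_arrClosure (S := S) (T := T) (A := insert e F))
    have h2 := hArr.corank_insert_of_notMem fun h ↦ heF (hF.arrClosure_subset subset_rfl h)
    have h3 := hle F
    rw [hGe] at h1
    simp only
    omega
  · intro F hF
    refine Set.Subset.antisymm (fun e he ↦ ?_)
      (hF.arrClosure_subset (Set.sUnion_subset fun a ha ↦ ha.2.2))
    by_cases h0 : e ∈ arrClosure S T ∅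
    · exact isArrFlat_arrClosure.arrClosure_subset (Set.empty_subset _) h0
    · refine subset_arrClosure (Set.mem_sUnion.2
        ⟨arrClosure S T {e}, ⟨isArrFlat_arrClosure, ?_, ?_⟩, subset_arrClosure rfl⟩)
      · have h1 := hArr.corank_insert_of_notMem h0
        rw [hArr.corank_empty, insert_empty_eq] at h1
        have h2 := hArr.corank_congr (interSpace_arrClosure (S := S) (T := T) (A := {e}))
        simp only
        omega
      · exact hF.arrClosure_subset (Set.singleton_subset_iff.2 he)
  · intro F G _ _
    have h1 := hArr.corank_supermodular G (Set.inter_subset_left (s := F) (t := G))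
    rw [Set.union_eq_right.2 Set.inter_subset_right] at h1
    simp only [hArr.corank_congr interSpace_arrClosure]
    have := hle (F ∩ G)
    have := hle (F ∪ G)
    have := hle F
    have := hle G
    omega
end
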